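/- Suprema over decompositions: in the setting M = ⊕⁴Mₙ(ℂ), N = {diag(A,A,A,A)}, E the averaging conditional expectation, for every state φ on M with φ∘E = φ and every finite decomposition φ = Σₓpₓφₓ, the entropic disturbance χ({pₓ},{φₓ}) − χ({pₓ},{φₓ|N}) is at most 2 log 2, and this bound is attained; hence the supremum over invariant states and decompositions equals 2 log 2 = log 4. -/

import Mathlib

open Matrix
open scoped ComplexOrder

/-- Matrix logarithm via the Hermitian functional calculus, with the convention
`Real.log 0 = 0` on the kernel (junk value `0` for non-Hermitian input). -/
noncomputable def mlog {n : ℕ} (A : Matrix (Fin n) (Fin n) ℂ) : Matrix (Fin n) (Fin n) ℂ :=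
  if h : A.IsHermitian then h.cfc Real.log else 0

/-- Umegaki relative entropy `S(ρ,σ) = Tr(ρ (log ρ - log σ))` (real part of the trace). -/
noncomputable def relEnt {n : ℕ} (ρ σ : Matrix (Fin n) (Fin n) ℂ) : ℝ :=
  ((ρ * (mlog ρ - mlog σ)).trace).re

/-- The support condition `supp ρ ≤ supp σ`, phrased as kernel containment
(`ker σ ⊆ ker ρ`), which is equivalent for positive semidefinite matrices. -/
def suppLE {n : ℕ} (ρ σ : Matrix (Fin n) (Fin n) ℂ) : Prop :=
  ∀ v : Fin n → ℂ, σ.mulVec v = 0 → ρ.mulVec v = 0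
/-- The averaging conditional expectation E(A₁⊕A₂⊕A₃⊕A₄) = B⊕B⊕B⊕B, B = (ΣAᵢ)/4, on
M = ⊕⁴Mₙ(ℂ), modelled as the Pi-algebra Fin 4 → Mₙ(ℂ). -/
noncomputable def Eavg {n : ℕ} (X : Fin 4 → Matrix (Fin n) (Fin n) ℂ) :
    Fin 4 → Matrix (Fin n) (Fin n) ℂ :=
  fun _ => (4 : ℂ)⁻¹ • ∑ i, X i

/-- Umegaki relative entropy on ⊕⁴Mₙ(ℂ): sum of blockwise contributions. -/
noncomputable def piRelEnt {n : ℕ} (ρ σ : Fin 4 → Matrix (Fin n) (Fin n) ℂ) : ℝ :=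
  ∑ i, relEnt (ρ i) (σ i)

/-- Density matrix of the restriction to the diagonal subalgebra N = {A⊕A⊕A⊕A} ≅ Mₙ(ℂ). -/
noncomputable def resD {n : ℕ} (ρ : Fin 4 → Matrix (Fin n) (Fin n) ℂ) :
    Matrix (Fin n) (Fin n) ℂ :=
  ∑ i, ρ i

/-- The entropic disturbance χ({pₓ},{φₓ}) − χ({pₓ},{φₓ|N}) of a finite decomposition
φ = Σₓ pₓφₓ of a state on ⊕⁴Mₙ(ℂ). -/
noncomputable def disturbance {n k : ℕ} (p : Fin k → ℝ)
    (φs : Fin k → (Fin 4 → Matrix (Fin n) (Fin n) ℂ))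
    (φ : Fin 4 → Matrix (Fin n) (Fin n) ℂ) : ℝ :=
  (∑ x, p x * piRelEnt (φs x) φ) - (∑ x, p x * relEnt (resD (φs x)) (resD φ))

/-- A state on ⊕⁴Mₙ(ℂ) (blockwise densities, total trace one). -/
def IsState {n : ℕ} (φ : Fin 4 → Matrix (Fin n) (Fin n) ℂ) : Prop :=
  (∀ i, (φ i).PosSemidef) ∧ (∑ i, (φ i).trace) = 1

/-- Invariance φ∘E = φ under the averaging conditional expectation. -/
def IsEInvariant {n : ℕ} (φ : Fin 4 → Matrix (Fin n) (Fin n) ℂ) : Prop :=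
  ∀ X : Fin 4 → Matrix (Fin n) (Fin n) ℂ,
    ∑ j, (φ j * Eavg X j).trace = ∑ j, (φ j * X j).trace

/-- A finite decomposition φ = Σₓ pₓ φₓ into states with probability weights pₓ. -/
def IsDecomposition {n k : ℕ} (p : Fin k → ℝ)
    (φs : Fin k → (Fin 4 → Matrix (Fin n) (Fin n) ℂ))
    (φ : Fin 4 → Matrix (Fin n) (Fin n) ℂ) : Prop :=
  (∀ x, 0 ≤ p x) ∧ (∑ x, p x = 1) ∧ (∀ x, IsState (φs x)) ∧
    (∀ i, φ i = ∑ x, (p x : ℂ) • φs x i)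

lemma aux_log {m : ℕ} (a : ℝ) (ha : 0 < a) (b w : Fin m → ℝ) (hb : ∀ j, 0 ≤ b j)
    (hw : ∀ j, 0 ≤ w j) (hw1 : ∑ j, w j = 1) (h0 : ∀ j, b j = 0 → w j = 0)
    (hs : a * (∑ j, w j / b j) ^ 2 ≤ ∑ j, w j / b j) :
    Real.log a ≤ ∑ j, w j * Real.log (b j) := by
  have hs1 : a * (∑ j, w j / b j) ≤ 1 := by
    have h : 0 ≤ ∑ j, w j / b j := Finset.sum_nonneg fun j _ => div_nonneg (hw j) (hb j)
    rcases h.eq_or_lt with h | h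
    · rw [← h]; simp
    · nlinarith
  have key : ∀ j, w j * (1 - a / b j + Real.log a) ≤ w j * Real.log (b j) := by
    intro j
    rcases (hb j).eq_or_lt with h | h
    · simp [h0 j h.symm]
    · apply mul_le_mul_of_nonneg_left _ (hw j)
      have := Real.one_sub_inv_le_log_of_pos (div_pos h ha)
      rw [Real.log_div h.ne' ha.ne', inv_div] at this
      linarith
  have := Finset.sum_le_sum fun j (_ : j ∈ Finset.univ) => key j
  have e : ∑ j, w j * (1 - a / b j + Real.log a)
      = (1 + Real.log a) * ∑ j, w j - a * ∑ j, w j / b j := by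
    rw [Finset.mul_sum, Finset.mul_sum, ← Finset.sum_sub_distrib]
    exact Finset.sum_congr rfl fun j _ => by ring
  rw [e, hw1] at this
  linarith

lemma aux_quad {m : ℕ} (a b : Fin m → ℝ) (W : Matrix (Fin m) (Fin m) ℂ)
    (h : (diagonal (fun j => (b j : ℂ)) - Wᴴ * diagonal (fun j => (a j : ℂ)) * W).PosSemidef)
    (x : Fin m → ℂ) :
    ∑ i, a i * Complex.normSq ((W *ᵥ x) i) ≤ ∑ j, b j * Complex.normSq (x j) := by
  have h1 := h.dotProduct_mulVec_nonneg x
  have e1 : ∀ (c : Fin m → ℝ) (y : Fin m → ℂ),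
      star y ⬝ᵥ (diagonal (fun j => (c j : ℂ)) *ᵥ y)
        = ((∑ j, c j * Complex.normSq (y j) : ℝ) : ℂ) := by
    intro c y
    simp only [dotProduct, mulVec_diagonal, Pi.star_apply, Complex.ofReal_sum,
      Complex.ofReal_mul, Complex.normSq_eq_conj_mul_self, RCLike.star_def]
    exact Finset.sum_congr rfl fun j _ => by ring
  have e2 : star x ⬝ᵥ ((Wᴴ * diagonal (fun j => (a j : ℂ)) * W) *ᵥ x)
      = star (W *ᵥ x) ⬝ᵥ (diagonal (fun j => (a j : ℂ)) *ᵥ (W *ᵥ x)) := by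
    rw [← mulVec_mulVec, ← mulVec_mulVec, dotProduct_mulVec, star_mulVec]
  rw [sub_mulVec, dotProduct_sub, e2, e1, e1, ← Complex.ofReal_sub] at h1
  have := Complex.zero_le_real.mp h1
  linarith

lemma aux_row {m : ℕ} (W : Matrix (Fin m) (Fin m) ℂ) (hW : W * Wᴴ = 1) (i : Fin m) :
    ∑ j, Complex.normSq (W i j) = 1 := by
  have := congrFun (congrFun hW i) i
  simp only [mul_apply, conjTranspose_apply, one_apply_eq, RCLike.star_def,
    Complex.mul_conj] at this
  exact_mod_cast this

lemma aux_core {m : ℕ} (a b : Fin m → ℝ) (ha : ∀ i, 0 ≤ a i) (hb : ∀ i, 0 ≤ b i)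
    (W : Matrix (Fin m) (Fin m) ℂ) (hW : W * Wᴴ = 1)
    (h : (diagonal (fun j => (b j : ℂ)) - Wᴴ * diagonal (fun j => (a j : ℂ)) * W).PosSemidef) :
    ∑ i, a i * Real.log (a i) ≤
      ∑ j, Real.log (b j) * ∑ i, a i * Complex.normSq (W i j) := by
  have e : ∑ j, Real.log (b j) * ∑ i, a i * Complex.normSq (W i j)
      = ∑ i, a i * ∑ j, Complex.normSq (W i j) * Real.log (b j) := by
    simp only [Finset.mul_sum]
    rw [Finset.sum_comm]
    exact Finset.sum_congr rfl fun i _ => Finset.sum_congr rfl fun j _ => by ring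
  rw [e]
  refine Finset.sum_le_sum fun i _ => ?_
  rcases (ha i).eq_or_lt with h0 | hai
  · simp [← h0]
  refine mul_le_mul_of_nonneg_left ?_ hai.le
  have hq : ∀ x : Fin m → ℂ, a i * Complex.normSq ((W *ᵥ x) i)
      ≤ ∑ j, b j * Complex.normSq (x j) := fun x =>
    le_trans (Finset.single_le_sum (f := fun i => a i * Complex.normSq ((W *ᵥ x) i))
      (fun k _ => mul_nonneg (ha k) (Complex.normSq_nonneg _)) (Finset.mem_univ i))
      (aux_quad a b W h x)
  apply aux_log _ hai b _ hb (fun j => Complex.normSq_nonneg _) (aux_row W hW i)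
  · intro j hj
    have := hq (Pi.single j 1)
    have e3 : ∑ k, b k * Complex.normSq ((Pi.single j 1 : Fin m → ℂ) k) = 0 := by
      refine Finset.sum_eq_zero fun k _ => ?_
      rcases eq_or_ne k j with rfl | hk
      · simp [hj]
      · simp [hk]
    rw [e3] at this
    simp only [mulVec_single_one, col_apply] at this
    have h2 := Complex.normSq_nonneg (W i j)
    nlinarith
  · have := hq (fun j => star (W i j) / (b j : ℂ))
    have e4 : (W *ᵥ (fun j => star (W i j) / (b j : ℂ))) i
        = ((∑ j, Complex.normSq (W i j) / b j : ℝ) : ℂ) := by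
      simp only [mulVec, dotProduct, Complex.ofReal_sum, Complex.ofReal_div,
        ← Complex.mul_conj, RCLike.star_def]
      exact Finset.sum_congr rfl fun j _ => by ring
    have e5 : ∑ j, b j * Complex.normSq (star (W i j) / (b j : ℂ))
        = ∑ j, Complex.normSq (W i j) / b j := by
      refine Finset.sum_congr rfl fun j _ => ?_
      rw [Complex.normSq_div, Complex.normSq_ofReal, RCLike.star_def, Complex.normSq_conj]
      rcases (hb j).eq_or_lt with h0 | h0
      · simp [← h0]
      · field_simp
    rw [e4, e5, Complex.normSq_ofReal] at this
    rw [pow_two]; exact this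

lemma trace_cfc {m : ℕ} (A B : Matrix (Fin m) (Fin m) ℂ) (hB : B.IsHermitian) (f : ℝ → ℝ) :
    ((A * hB.cfc f).trace).re = ∑ j, f (hB.eigenvalues j) *
      (((hB.eigenvectorUnitary : Matrix (Fin m) (Fin m) ℂ)ᴴ * A * hB.eigenvectorUnitary) j j).re := by
  rw [IsHermitian.cfc, Unitary.conjStarAlgAut_apply, ← mul_assoc, trace_mul_comm, ← mul_assoc,
    ← mul_assoc, trace, Complex.re_sum]
  refine Finset.sum_congr rfl fun j _ => ?_
  rw [diag_apply, mul_diagonal, mul_comm, star_eq_conjTranspose]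
  simp

lemma spec {m : ℕ} (A : Matrix (Fin m) (Fin m) ℂ) (hA : A.IsHermitian) :
    A = (hA.eigenvectorUnitary : Matrix (Fin m) (Fin m) ℂ) * diagonal (fun j => (hA.eigenvalues j : ℂ)) *
      (hA.eigenvectorUnitary : Matrix (Fin m) (Fin m) ℂ)ᴴ := by
  conv_lhs => rw [hA.spectral_theorem, Unitary.conjStarAlgAut_apply]
  rfl

lemma mlog_mono {m : ℕ} (A B : Matrix (Fin m) (Fin m) ℂ) (hA : A.PosSemidef)
    (hBA : (B - A).PosSemidef) :
    ((A * mlog A).trace).re ≤ ((A * mlog B).trace).re := by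
  have hB : B.PosSemidef := by simpa using hA.add hBA
  rw [mlog, mlog, dif_pos hA.1, dif_pos hB.1, trace_cfc, trace_cfc]
  set U : Matrix (Fin m) (Fin m) ℂ := (hA.1.eigenvectorUnitary).val
  set V : Matrix (Fin m) (Fin m) ℂ := (hB.1.eigenvectorUnitary).val
  have hUU : Uᴴ * U = 1 := Unitary.coe_star_mul_self hA.1.eigenvectorUnitary
  have hUU' : U * Uᴴ = 1 := Unitary.coe_mul_star_self hA.1.eigenvectorUnitary
  have hVV : Vᴴ * V = 1 := Unitary.coe_star_mul_self hB.1.eigenvectorUnitary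
  have hVV' : V * Vᴴ = 1 := Unitary.coe_mul_star_self hB.1.eigenvectorUnitary
  have sA : A = U * diagonal (fun j => (hA.1.eigenvalues j : ℂ)) * Uᴴ := spec A hA.1
  have sB : B = V * diagonal (fun j => (hB.1.eigenvalues j : ℂ)) * Vᴴ := spec B hB.1
  set a := hA.1.eigenvalues
  set b := hB.1.eigenvalues
  have eA : Uᴴ * A * U = diagonal (fun j => (a j : ℂ)) := by
    conv_lhs => rw [sA]
    rw [← mul_assoc, ← mul_assoc, hUU, one_mul, mul_assoc, hUU, mul_one]
  have eB : Vᴴ * B * V = diagonal (fun j => (b j : ℂ)) := by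
    conv_lhs => rw [sB]
    rw [← mul_assoc, ← mul_assoc, hVV, one_mul, mul_assoc, hVV, mul_one]
  have eAV : Vᴴ * A * V = (Uᴴ * V)ᴴ * diagonal (fun j => (a j : ℂ)) * (Uᴴ * V) := by
    conv_lhs => rw [sA]
    simp only [conjTranspose_mul, conjTranspose_conjTranspose, mul_assoc]
  have hW : (Uᴴ * V) * (Uᴴ * V)ᴴ = 1 := by
    rw [conjTranspose_mul, conjTranspose_conjTranspose, mul_assoc, ← mul_assoc V, hVV', one_mul,
      hUU]
  have hps := hBA.conjTranspose_mul_mul_same V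
  rw [mul_sub, sub_mul, eB, eAV] at hps
  have := aux_core a b hA.eigenvalues_nonneg hB.eigenvalues_nonneg _ hW hps
  rw [eA, eAV]
  convert this using 1
  · exact Finset.sum_congr rfl fun j _ => by simp [mul_comm]
  · refine Finset.sum_congr rfl fun j _ => ?_
    congr 1
    rw [mul_apply, Complex.re_sum]
    refine Finset.sum_congr rfl fun i _ => ?_
    rw [mul_diagonal, conjTranspose_apply, RCLike.star_def, mul_right_comm,
      ← Complex.normSq_eq_conj_mul_self, ← Complex.ofReal_mul, Complex.ofReal_re, mul_comm]

lemma mlog_eq {m : ℕ} (A : Matrix (Fin m) (Fin m) ℂ) (hA : A.IsHermitian) :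
    mlog A = cfc Real.log A := by
  rw [mlog, dif_pos hA, hA.cfc_eq]

lemma mlog_four {m : ℕ} (A : Matrix (Fin m) (Fin m) ℂ) (hA : A.IsHermitian) :
    mlog ((4 : ℝ) • A) = hA.cfc (fun x => Real.log (4 * x)) := by
  have h4 : ((4 : ℝ) • A).IsHermitian := hA.smul (by simp [isSelfAdjoint_iff])
  rw [mlog_eq _ h4, ← hA.cfc_eq]
  exact (cfc_comp_const_mul (4 : ℝ) Real.log A
    (hf := ((finite_real_spectrum (A := A)).image _).continuousOn _) (ha := hA)).symm

lemma trace_four {m : ℕ} (A B : Matrix (Fin m) (Fin m) ℂ) (hA : A.PosSemidef)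
    (hB : B.PosSemidef) :
    ((A * mlog ((4 : ℝ) • B)).trace).re ≤ ((A * mlog B).trace).re + Real.log 4 * A.trace.re := by
  rw [mlog_four B hB.1, mlog, dif_pos hB.1, trace_cfc, trace_cfc]
  have hps := hA.conjTranspose_mul_mul_same
    (hB.1.eigenvectorUnitary : Matrix (Fin m) (Fin m) ℂ)
  have ht : A.trace = ((hB.1.eigenvectorUnitary : Matrix (Fin m) (Fin m) ℂ)ᴴ * A *
      hB.1.eigenvectorUnitary).trace := by
    rw [trace_mul_comm, ← mul_assoc]
    have : (hB.1.eigenvectorUnitary : Matrix (Fin m) (Fin m) ℂ) *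
      (hB.1.eigenvectorUnitary : Matrix (Fin m) (Fin m) ℂ)ᴴ = 1 :=
      Unitary.coe_mul_star_self hB.1.eigenvectorUnitary
    rw [this, one_mul]
  rw [ht, trace, Complex.re_sum, Finset.mul_sum, ← Finset.sum_add_distrib]
  refine Finset.sum_le_sum fun j _ => ?_
  rw [diag_apply, ← add_mul]
  refine mul_le_mul_of_nonneg_right ?_ (Complex.le_def.mp (hps.diag_nonneg (i := j))).1
  rcases (hB.eigenvalues_nonneg j).eq_or_lt with h | h
  · rw [← h]; simp; exact Real.log_nonneg (by norm_num)
  · rw [Real.log_mul (by norm_num) h.ne', add_comm]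

lemma inv_eq {m : ℕ} (φ : Fin 4 → Matrix (Fin m) (Fin m) ℂ) (h : IsEInvariant φ) (i : Fin 4) :
    resD φ = (4 : ℝ) • φ i := by
  have key : (4 : ℂ)⁻¹ • resD φ = φ i := by
    rw [Matrix.ext_iff_trace_mul_right]
    intro X
    have := h (Pi.single i X)
    have e : ∑ j, (φ j * (Pi.single i X : Fin 4 → Matrix (Fin m) (Fin m) ℂ) j).trace
        = (φ i * X).trace := by
      rw [Finset.sum_eq_single i (by intro j _ hj; simp [hj]) (by simp), Pi.single_eq_same]
    rw [e] at this
    rw [← this]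
    simp only [Eavg, Finset.sum_pi_single', Finset.mem_univ, if_true, resD]
    simp [Matrix.sum_mul, trace_sum, Finset.mul_sum]
  rw [← key, ← Complex.coe_smul, smul_smul]
  norm_num

lemma mlog_smul_one {m : ℕ} (c : ℝ) :
    mlog ((c : ℂ) • (1 : Matrix (Fin m) (Fin m) ℂ)) = (Real.log c : ℂ) • 1 := by
  have h : ((c : ℂ) • (1 : Matrix (Fin m) (Fin m) ℂ)).IsHermitian :=
    isHermitian_one.smul (by simp [isSelfAdjoint_iff])
  rw [mlog_eq _ h]
  have e : ∀ r : ℝ, (r : ℂ) • (1 : Matrix (Fin m) (Fin m) ℂ) = algebraMap ℝ _ r := by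
    intro r
    rw [Algebra.algebraMap_eq_smul_one, Complex.coe_smul]
  rw [e, e, cfc_algebraMap]


lemma relEnt_eq {m : ℕ} (ρ σ : Matrix (Fin m) (Fin m) ℂ) :
    relEnt ρ σ = ((ρ * mlog ρ).trace).re - ((ρ * mlog σ).trace).re := by
  rw [relEnt, mul_sub, trace_sub, Complex.sub_re]

lemma sum_tr {m : ℕ} (ρ : Fin 4 → Matrix (Fin m) (Fin m) ℂ) (L : Matrix (Fin m) (Fin m) ℂ) :
    ∑ i, ((ρ i * L).trace).re = ((resD ρ * L).trace).re := by
  rw [resD, Matrix.sum_mul, trace_sum, Complex.re_sum]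

lemma bound_one {m : ℕ} (ρ φ : Fin 4 → Matrix (Fin m) (Fin m) ℂ) (hρ : IsState ρ)
    (hφ : IsState φ) (hE : IsEInvariant φ) :
    piRelEnt ρ φ - relEnt (resD ρ) (resD φ) ≤ Real.log 4 := by
  have hc : ∀ i, φ i = φ 0 := fun i => by
    have := (inv_eq φ hE i).symm.trans (inv_eq φ hE 0)
    exact smul_right_injective _ (by norm_num : (4 : ℝ) ≠ 0) this
  have hR : (resD ρ).PosSemidef := posSemidef_sum _ fun i _ => hρ.1 i
  have h1 : ∑ i, ((ρ i * mlog (ρ i)).trace).re ≤ ((resD ρ * mlog (resD ρ)).trace).re := by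
    rw [← sum_tr]
    refine Finset.sum_le_sum fun i _ => mlog_mono _ _ (hρ.1 i) ?_
    have : resD ρ - ρ i = ∑ j ∈ Finset.univ.erase i, ρ j := by
      rw [resD, ← Finset.add_sum_erase _ _ (Finset.mem_univ i), add_sub_cancel_left]
    rw [this]
    exact posSemidef_sum _ fun j _ => hρ.1 j
  have h2 := trace_four (resD ρ) (φ 0) hR (hφ.1 0)
  rw [← inv_eq φ hE 0] at h2
  have ht : (resD ρ).trace = 1 := by rw [resD, trace_sum]; exact hρ.2
  rw [ht, Complex.one_re, mul_one] at h2
  have h3 : piRelEnt ρ φ = ∑ i, ((ρ i * mlog (ρ i)).trace).re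
      - ((resD ρ * mlog (φ 0)).trace).re := by
    rw [← sum_tr, ← Finset.sum_sub_distrib, piRelEnt]
    exact Finset.sum_congr rfl fun i _ => by rw [relEnt_eq, hc i]
  rw [h3, relEnt_eq]
  linarith

lemma relEnt_one {m : ℕ} (c d : ℝ) :
    relEnt ((c : ℂ) • (1 : Matrix (Fin m) (Fin m) ℂ)) ((d : ℂ) • 1)
      = m * c * (Real.log c - Real.log d) := by
  rw [relEnt, mlog_smul_one, mlog_smul_one, ← sub_smul, smul_mul_smul_comm, mul_one, trace_smul,
    trace_one, Fintype.card_fin, ← Complex.ofReal_sub, ← Complex.ofReal_mul, smul_eq_mul,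
    ← Complex.ofReal_natCast, ← Complex.ofReal_mul, Complex.ofReal_re]
  ring

lemma attained {n : ℕ} (hn : 0 < n) :
    ∃ (k : ℕ) (φ : Fin 4 → Matrix (Fin n) (Fin n) ℂ)
      (p : Fin k → ℝ) (φs : Fin k → (Fin 4 → Matrix (Fin n) (Fin n) ℂ)),
      IsState φ ∧ IsEInvariant φ ∧ IsDecomposition p φs φ ∧
      disturbance p φs φ = Real.log 4 := by
  have hn0 : (n : ℝ) ≠ 0 := by positivity
  have hn' : (n : ℂ) ≠ 0 := by exact_mod_cast hn.ne'
  have hps : ∀ c : ℝ, 0 ≤ c → ((c : ℂ) • (1 : Matrix (Fin n) (Fin n) ℂ)).PosSemidef :=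
    fun c hc => PosSemidef.one.smul (Complex.zero_le_real.mpr hc)
  have hinv : (0 : ℝ) ≤ (n : ℝ)⁻¹ := by positivity
  have h0 : (0 : Matrix (Fin n) (Fin n) ℂ) = ((0 : ℝ) : ℂ) • 1 := by simp
  have hres : ∀ x : Fin 4, resD (fun i => if x = i then
      (((n : ℝ)⁻¹ : ℝ) : ℂ) • (1 : Matrix (Fin n) (Fin n) ℂ) else 0)
        = (((n : ℝ)⁻¹ : ℝ) : ℂ) • 1 := by
    intro x; simp [resD]
  have hresφ : resD (fun _ => (((n : ℝ)⁻¹ / 4 : ℝ) : ℂ) • (1 : Matrix (Fin n) (Fin n) ℂ))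
        = (((n : ℝ)⁻¹ : ℝ) : ℂ) • 1 := by
    simp only [resD, Finset.sum_const, Finset.card_univ, Fintype.card_fin, ← Nat.cast_smul_eq_nsmul ℂ,
      smul_smul]
    congr 1; push_cast; ring
  refine ⟨4, fun _ => (((n : ℝ)⁻¹ / 4 : ℝ) : ℂ) • 1, fun _ => 4⁻¹,
    fun x i => if x = i then (((n : ℝ)⁻¹ : ℝ) : ℂ) • 1 else 0, ⟨fun i => hps _ (by positivity), ?_⟩,
    ?_, ⟨fun _ => by norm_num, by simp, fun x => ⟨fun i => ?_, ?_⟩, fun i => ?_⟩, ?_⟩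
  · rw [← trace_sum]
    change (resD _).trace = 1
    rw [hresφ]; simp [hn']
  · intro X
    simp [Eavg, trace_sum, Finset.mul_sum, Fin.sum_univ_four]
    ring
  · dsimp only
    split_ifs
    · exact hps _ hinv
    · exact PosSemidef.zero
  · rw [← trace_sum]
    change (resD _).trace = 1
    rw [hres]; simp [hn']
  · simp [smul_smul]
    congr 1; ring
  · have hp : ∀ x : Fin 4, piRelEnt (fun i => if x = i then
        (((n : ℝ)⁻¹ : ℝ) : ℂ) • (1 : Matrix (Fin n) (Fin n) ℂ) else 0)
        (fun _ => (((n : ℝ)⁻¹ / 4 : ℝ) : ℂ) • 1) = Real.log 4 := by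
      intro x
      rw [piRelEnt, Finset.sum_eq_single x (by
        intro j _ hj
        rw [if_neg hj.symm, relEnt, zero_mul, trace_zero, Complex.zero_re]) (by simp),
        if_pos rfl, relEnt_one, Real.log_div (by positivity) (by norm_num),
        mul_inv_cancel₀ hn0]
      ring
    simp only [disturbance, hp, hres, hresφ, relEnt_one, sub_self, mul_zero]
    simp

/-- for every E-invariant state φ on ⊕⁴Mₙ(ℂ) and every finite decomposition
φ = Σₓ pₓφₓ, the entropic disturbance is at most 2 log 2; this bound is attained; hence
the supremum over invariant states and decompositions equals 2 log 2 = log 4. -/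
theorem stmt16 {n : ℕ} (hn : 0 < n) :
    (∀ (k : ℕ) (φ : Fin 4 → Matrix (Fin n) (Fin n) ℂ)
      (p : Fin k → ℝ) (φs : Fin k → (Fin 4 → Matrix (Fin n) (Fin n) ℂ)),
      IsState φ → IsEInvariant φ → IsDecomposition p φs φ →
      disturbance p φs φ ≤ 2 * Real.log 2) ∧
    (∃ (k : ℕ) (φ : Fin 4 → Matrix (Fin n) (Fin n) ℂ)
      (p : Fin k → ℝ) (φs : Fin k → (Fin 4 → Matrix (Fin n) (Fin n) ℂ)),
      IsState φ ∧ IsEInvariant φ ∧ IsDecomposition p φs φ ∧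
      disturbance p φs φ = 2 * Real.log 2) ∧
    (2 * Real.log 2 = Real.log 4) := by
  have h4 : 2 * Real.log 2 = Real.log 4 := by
    rw [show (4 : ℝ) = 2 ^ 2 by norm_num, Real.log_pow]; norm_num
  rw [h4]
  refine ⟨?_, attained hn, rfl⟩
  intro k φ p φs hφ hE ⟨hp, hp1, hs, _⟩
  rw [disturbance, ← Finset.sum_sub_distrib]
  calc _ ≤ ∑ x, p x * Real.log 4 := by
        refine Finset.sum_le_sum fun x _ => ?_
        rw [← mul_sub]
        exact mul_le_mul_of_nonneg_left (bound_one _ _ (hs x) hφ hE) (hp x)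
    _ = Real.log 4 := by rw [← Finset.sum_mul, hp1, one_mul]
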